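/- Fourth-moment bound for the truncated Brownian increment with general truncation level: Let W be a standard one-dimensional Brownian motion, let h ∈ (0,1], let K > 0, set A := K√(h log(1/h)), and let τ := inf{t ≥ 0 : |W_t| ≥ A}. Then E[(W_h − W_{h∧τ})⁴] ≤ 6 h^{2 + K²/2}. -/

import Mathlib

open MeasureTheory ProbabilityTheory
open scoped NNReal

/-- A standard one-dimensional Brownian motion (Wiener process) on a probability space:
a process `W` with `W 0 = 0`, a.s. continuous paths, Gaussian increments
`W t − W s ~ N(0, t − s)` for `0 ≤ s ≤ t`, each such increment being independent of
the past `σ(W r : 0 ≤ r ≤ s)`.  (Equivalently, a continuous centered Gaussian process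
with `W 0 = 0` and covariance `Cov(W s, W t) = min s t`.) -/
structure IsBrownianMotion {Ω : Type*} [MeasurableSpace Ω] (P : Measure Ω)
    (W : ℝ → Ω → ℝ) : Prop where
  isProb : IsProbabilityMeasure P
  meas : ∀ t, Measurable (W t)
  start : ∀ ω, W 0 ω = 0
  cont : ∀ᵐ ω ∂P, Continuous fun t => W t ω
  incr : ∀ s t : ℝ, 0 ≤ s → s ≤ t →
    P.map (fun ω => W t ω - W s ω) = gaussianReal 0 (Real.toNNReal (t - s))
  indep : ∀ s t : ℝ, 0 ≤ s → s ≤ t →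
    Indep (MeasurableSpace.comap (fun ω => W t ω - W s ω) inferInstance)
      (⨆ r ∈ Set.Icc (0 : ℝ) s, MeasurableSpace.comap (W r) inferInstance) P

lemma deriv_aux (v : ℝ) (p q : ℝ → ℝ) (hp : ∀ t, HasDerivAt p (q t) t) :
    deriv (fun t => p t * Real.exp (v * t ^ 2 / 2)) =
      fun t => (q t + v * t * p t) * Real.exp (v * t ^ 2 / 2) := by
  funext t
  have h1 : HasDerivAt (fun t : ℝ => v * t ^ 2 / 2) (v * t) t := by
    have := (((hasDerivAt_id t).pow 2).const_mul v).div_const 2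
    refine this.congr_deriv ?_
    simp; ring
  have := (hp t).mul h1.exp
  refine (HasDerivAt.congr_deriv (f := fun t => p t * Real.exp (v * t ^ 2 / 2)) this ?_).deriv
  ring

lemma gauss4 (v : ℝ≥0) :
    ∫⁻ x, ENNReal.ofReal (x ^ 4) ∂(gaussianReal 0 v) = ENNReal.ofReal (3 * (v : ℝ) ^ 2) := by
  have hint : Integrable (fun x : ℝ => x ^ 4) (gaussianReal 0 v) := by
    have := (memLp_id_gaussianReal (μ := 0) (v := v) 4).integrable_norm_pow (by norm_num)
    have e : (fun x : ℝ => ‖id x‖ ^ 4) = fun x => x ^ 4 := by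
      funext x
      simp only [id, Real.norm_eq_abs]
      exact (show Even 4 by decide).pow_abs x
    rw [← e]
    exact_mod_cast this
  rw [← ofReal_integral_eq_lintegral_ofReal hint (ae_of_all _ fun x => by positivity)]
  congr 1
  have h0 := iteratedDeriv_mgf_zero (X := id) (μ := gaussianReal 0 v)
    (by simp [integrableExpSet_id_gaussianReal]) 4
  rw [mgf_id_gaussianReal] at h0
  have : (fun x : ℝ => x ^ 4) = (id : ℝ → ℝ) ^ 4 := by ext; simp
  rw [this, ← h0]
  simp only [iteratedDeriv_succ', iteratedDeriv_zero]
  have e0 : (fun t : ℝ => Real.exp (0 * t + v * t ^ 2 / 2))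
      = fun t => (fun _ => (1:ℝ)) t * Real.exp (v * t ^ 2 / 2) := by funext; simp
  rw [e0, deriv_aux v _ (fun _ => 0) (fun t => hasDerivAt_const _ _)]
  rw [deriv_aux v (fun t => 0 + v * t * 1) (fun _ => v) (fun t => by
    simpa using (hasDerivAt_id t).const_mul (v : ℝ))]
  rw [deriv_aux v (fun t => v + v * t * (0 + v * t * 1)) (fun t => 2 * v ^ 2 * t) (fun t => by
    have := (((hasDerivAt_id t).pow 2).const_mul ((v : ℝ) ^ 2)).const_add (v : ℝ)
    refine (this.congr_deriv (by simp; ring)).congr_of_eventuallyEq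
      (Filter.Eventually.of_forall fun x => by simp; ring))]
  rw [deriv_aux v (fun t => 2 * v ^ 2 * t + v * t * (v + v * t * (0 + v * t * 1)))
    (fun t => 3 * v ^ 2 + 3 * v ^ 3 * t ^ 2) (fun t => by
    have := (((hasDerivAt_id t).pow 3).const_mul ((v : ℝ) ^ 3)).add
      ((hasDerivAt_id t).const_mul (3 * (v : ℝ) ^ 2))
    refine (this.congr_deriv (by simp; ring)).congr_of_eventuallyEq
      (Filter.Eventually.of_forall fun x => by simp; ring))]
  simp

lemma gauss_exp (v : ℝ≥0) (l : ℝ) :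
    ∫⁻ x, ENNReal.ofReal (Real.exp (l * x)) ∂(gaussianReal 0 v)
      = ENNReal.ofReal (Real.exp (v * l ^ 2 / 2)) := by
  rw [← ofReal_integral_eq_lintegral_ofReal (integrable_exp_mul_gaussianReal l)
    (ae_of_all _ fun x => by positivity)]
  congr 1
  have := congrFun (mgf_id_gaussianReal (μ := 0) (v := v)) l
  simpa [mgf] using this

/-- the past sigma-algebra -/
abbrev past {Ω : Type*} (W : ℝ → Ω → ℝ) (s : ℝ) : MeasurableSpace Ω :=
  ⨆ r ∈ Set.Icc (0 : ℝ) s, MeasurableSpace.comap (W r) inferInstance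

lemma past_meas {Ω : Type*} (W : ℝ → Ω → ℝ) {s r : ℝ} (h0 : 0 ≤ r) (hr : r ≤ s) :
    Measurable[past W s] (W r) := by
  apply Measurable.of_comap_le
  exact le_iSup₂_of_le (f := fun r (_ : r ∈ Set.Icc (0:ℝ) s) =>
    MeasurableSpace.comap (W r) inferInstance) r ⟨h0, hr⟩ le_rfl

section
variable {Ω : Type*} [mΩ : MeasurableSpace Ω] {P : Measure Ω} {W : ℝ → Ω → ℝ}

lemma past_le (hW : IsBrownianMotion P W) (s : ℝ) : past W s ≤ mΩ :=
  iSup₂_le fun r _ => (hW.meas r).comap_le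

lemma factor (hW : IsBrownianMotion P W) {s t : ℝ} (hs : 0 ≤ s) (hst : s ≤ t)
    (g : ℝ → ENNReal) (hg : Measurable g) (f : Ω → ENNReal) (hf : Measurable[past W s] f) :
    ∫⁻ ω, g (W t ω - W s ω) * f ω ∂P
      = (∫⁻ x, g x ∂(gaussianReal 0 (Real.toNNReal (t - s)))) * ∫⁻ ω, f ω ∂P := by
  have hm : Measurable (fun ω => W t ω - W s ω) := (hW.meas t).sub (hW.meas s)
  rw [lintegral_mul_eq_lintegral_mul_lintegral_of_independent_measurableSpace
    (f := fun ω => g (W t ω - W s ω)) hm.comap_le (past_le hW s) (hW.indep s t hs hst)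
    (hg.comp (comap_measurable _)) hf, ← hW.incr s t hs hst, lintegral_map hg hm]

lemma maximal_fin (hW : IsBrownianMotion P W) {h : ℝ} (hh : 0 ≤ h) (T : Finset ℝ)
    (hT : ∀ s ∈ T, s ∈ Set.Icc 0 h) (l b : ℝ) :
    P (⋃ s ∈ T, {ω | b ≤ l * W s ω}) ≤ ENNReal.ofReal (Real.exp (-b + h * l ^ 2 / 2)) := by
  have := hW.isProb
  set B : ℝ → Set Ω := fun s => {ω | b ≤ l * W s ω} \ ⋃ r ∈ T.filter (· < s), {ω | b ≤ l * W r ω}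
    with hB
  have hsub : ∀ s, B s ⊆ {ω | b ≤ l * W s ω} := fun s => Set.sdiff_subset
  have hBm : ∀ s ∈ T, MeasurableSet[past W s] (B s) := by
    intro s hs
    have hle : ∀ r ∈ T, r ≤ s → MeasurableSet[past W s] {ω | b ≤ l * W r ω} := by
      intro r hr hrs
      have : Measurable[past W s] (fun ω => l * W r ω) :=
        (past_meas W (hT r hr).1 hrs).const_mul l
      exact this measurableSet_Ici
    refine MeasurableSet.diff (hle s hs le_rfl) ?_
    refine Finset.measurableSet_biUnion _ fun r hr => ?_
    simp only [Finset.mem_filter] at hr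
    exact hle r hr.1 hr.2.le
  have hBm' : ∀ s ∈ T, MeasurableSet (B s) := fun s hs => past_le hW s _ (hBm s hs)
  have hdisj : (T : Set ℝ).PairwiseDisjoint B := by
    have key : ∀ r ∈ T, ∀ s ∈ T, r < s → Disjoint (B r) (B s) := by
      intro r hr s hs hrs
      rw [Set.disjoint_left]
      intro ω h1 h2
      refine h2.2 ?_
      simp only [Set.mem_iUnion, Finset.mem_filter]
      exact ⟨r, ⟨hr, hrs⟩, h1.1⟩
    intro r hr s hs hne
    rcases lt_or_gt_of_ne hne with hlt | hlt
    · exact key r hr s hs hlt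
    · exact (key s hs r hr hlt).symm
  have hcov : (⋃ s ∈ T, {ω | b ≤ l * W s ω}) ⊆ ⋃ s ∈ T, B s := by
    intro ω hω
    simp only [Set.mem_iUnion, Set.mem_ofPred_eq] at hω
    obtain ⟨s, hs, hsω⟩ := hω
    classical
    obtain ⟨m, hm, hmin⟩ := Finset.exists_min_image (T.filter fun s => b ≤ l * W s ω) id
      ⟨s, by simp [hs, hsω]⟩
    simp only [Finset.mem_filter, id] at hm hmin
    simp only [Set.mem_iUnion]
    refine ⟨m, hm.1, hm.2, ?_⟩
    simp only [Set.mem_iUnion, Finset.mem_filter, Set.mem_ofPred_eq]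
    rintro ⟨r, ⟨hr, hrm⟩, hrω⟩
    exact absurd (hmin r ⟨hr, hrω⟩) (not_le.2 hrm)
  have hE : ∫⁻ ω, ENNReal.ofReal (Real.exp (l * W h ω)) ∂P
      = ENNReal.ofReal (Real.exp (h * l ^ 2 / 2)) := by
    have := factor hW le_rfl hh (fun x => ENNReal.ofReal (Real.exp (l * x))) (by fun_prop)
      (fun _ => 1) measurable_const
    simpa [hW.start, gauss_exp, hh] using this
  have hterm : ∀ s ∈ T, ENNReal.ofReal (Real.exp b) * P (B s)
      ≤ ∫⁻ ω in B s, ENNReal.ofReal (Real.exp (l * W h ω)) ∂P := by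
    intro s hs
    have h1 := factor hW (hT s hs).1 (hT s hs).2 (fun x => ENNReal.ofReal (Real.exp (l * x)))
      (by fun_prop) ((B s).indicator fun _ => ENNReal.ofReal (Real.exp b))
      (measurable_const.indicator (hBm s hs))
    rw [gauss_exp, lintegral_indicator_const (hBm' s hs)] at h1
    calc ENNReal.ofReal (Real.exp b) * P (B s)
        ≤ ENNReal.ofReal (Real.exp ((h - s).toNNReal * l ^ 2 / 2)) *
          (ENNReal.ofReal (Real.exp b) * P (B s)) := by
          refine le_mul_of_one_le_left' ?_
          rw [ENNReal.one_le_ofReal]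
          exact Real.one_le_exp (by positivity)
      _ = _ := h1.symm
      _ ≤ _ := by
          rw [← lintegral_indicator (hBm' s hs)]
          refine lintegral_mono fun ω => ?_
          by_cases hω : ω ∈ B s
          · simp only [hω, Set.indicator_of_mem]
            rw [← ENNReal.ofReal_mul (by positivity), ← Real.exp_add]
            refine ENNReal.ofReal_le_ofReal (Real.exp_le_exp.2 ?_)
            have : b ≤ l * W s ω := hsub s hω
            linarith
          · simp [hω]
  have hsum : ENNReal.ofReal (Real.exp b) * P (⋃ s ∈ T, B s)
      ≤ ENNReal.ofReal (Real.exp (h * l ^ 2 / 2)) := by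
    rw [measure_biUnion_finset hdisj hBm', Finset.mul_sum]
    refine (Finset.sum_le_sum hterm).trans ?_
    rw [← lintegral_biUnion_finset hdisj hBm', ← hE]
    exact setLIntegral_le_lintegral _ _
  refine (measure_mono hcov).trans ?_
  have h2 : ENNReal.ofReal (Real.exp (-b + h * l ^ 2 / 2))
      = ENNReal.ofReal (Real.exp (-b)) * ENNReal.ofReal (Real.exp (h * l ^ 2 / 2)) := by
    rw [Real.exp_add, ENNReal.ofReal_mul (by positivity)]
  have h3 : ENNReal.ofReal (Real.exp (-b)) * ENNReal.ofReal (Real.exp b) = 1 := by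
    rw [← ENNReal.ofReal_mul (by positivity), ← Real.exp_add]; simp
  calc P (⋃ s ∈ T, B s)
      = ENNReal.ofReal (Real.exp (-b)) * (ENNReal.ofReal (Real.exp b) * P (⋃ s ∈ T, B s)) := by
        rw [← mul_assoc, h3, one_mul]
    _ ≤ _ := by rw [h2]; gcongr

lemma maximal_count (hW : IsBrownianMotion P W) {h : ℝ} (hh : 0 ≤ h) {ι : Type*} [Countable ι]
    (s : ι → ℝ) (hs : ∀ i, s i ∈ Set.Icc 0 h) (l b : ℝ) :
    P (⋃ i, {ω | b ≤ l * W (s i) ω}) ≤ ENNReal.ofReal (Real.exp (-b + h * l ^ 2 / 2)) := by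
  classical
  rw [Set.iUnion_eq_iUnion_finset, Directed.measure_iUnion]
  · refine iSup_le fun T => ?_
    refine le_trans (measure_mono ?_) (maximal_fin hW hh (T.image s) (by
      intro r hr
      obtain ⟨i, _, rfl⟩ := Finset.mem_image.1 hr
      exact hs i) l b)
    intro ω
    simp only [Set.mem_iUnion, Finset.mem_image]
    rintro ⟨i, hi, hω⟩
    exact ⟨s i, ⟨i, hi, rfl⟩, hω⟩
  · refine Monotone.directed_le fun T T' hTT' => ?_
    exact Set.biUnion_subset_biUnion_left hTT'

/-- event that `|W|` reaches `A` before `t` -/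
def hitE (W : ℝ → Ω → ℝ) (A t : ℝ) : Set Ω :=
  ⋂ m : ℕ, ⋃ q : ℚ, {ω | A - 1 / ((m : ℝ) + 1) < |W (max 0 (min (q : ℝ) t)) ω|}

lemma hitE_meas (A : ℝ) {t : ℝ} (ht : 0 ≤ t) : MeasurableSet[past W t] (hitE W A t) := by
  refine MeasurableSet.iInter fun m => MeasurableSet.iUnion fun q => ?_
  have h1 : Measurable[past W t] (fun ω => W (max 0 (min (q : ℝ) t)) ω) :=
    past_meas W (le_max_left _ _) (max_le ht (min_le_right _ _))
  have : Measurable[past W t] (fun ω => |W (max 0 (min (q : ℝ) t)) ω|) :=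
    continuous_abs.measurable.comp h1
  exact this measurableSet_Ioi

lemma mem_hitE_iff {A t : ℝ} (ht : 0 ≤ t) {ω : Ω} (hc : Continuous fun t => W t ω)
    (hne : {t : ℝ | 0 ≤ t ∧ A ≤ |W t ω|}.Nonempty) :
    ω ∈ hitE W A t ↔ sInf {t : ℝ | 0 ≤ t ∧ A ≤ |W t ω|} ≤ t := by
  have hbdd : BddBelow {t : ℝ | 0 ≤ t ∧ A ≤ |W t ω|} := ⟨0, fun x hx => hx.1⟩
  have hcl : IsClosed {t : ℝ | 0 ≤ t ∧ A ≤ |W t ω|} :=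
    (isClosed_le continuous_const continuous_id).inter (isClosed_le continuous_const hc.abs)
  simp only [hitE, Set.mem_iInter, Set.mem_iUnion, Set.mem_ofPred_eq]
  constructor
  · intro H
    obtain ⟨s, hs, hmax⟩ := (isCompact_Icc (a := (0:ℝ)) (b := t)).exists_isMaxOn ⟨0, le_rfl, ht⟩
      hc.abs.continuousOn
    have : A ≤ |W s ω| := by
      refine le_of_forall_pos_lt_add fun ε hε => ?_
      obtain ⟨m, hm⟩ := exists_nat_one_div_lt hε
      obtain ⟨q, hq⟩ := H m
      have : |W (max 0 (min (q : ℝ) t)) ω| ≤ |W s ω| :=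
        hmax ⟨le_max_left _ _, max_le ht (min_le_right _ _)⟩
      linarith
    exact (csInf_le hbdd ⟨hs.1, this⟩).trans hs.2
  · intro H m
    obtain ⟨h0, hA⟩ := hcl.csInf_mem hne hbdd
    set τ := sInf {t : ℝ | 0 ≤ t ∧ A ≤ |W t ω|}
    have hc' : Continuous fun x : ℝ => |W (max 0 (min x t)) ω| :=
      (hc.comp (f := fun x : ℝ => max 0 (min x t)) (by fun_prop)).abs
    have ho : IsOpen {x : ℝ | A - 1 / ((m : ℝ) + 1) < |W (max 0 (min x t)) ω|} :=
      isOpen_lt continuous_const hc'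
    obtain ⟨x, hx, q, rfl⟩ := Rat.denseRange_cast.inter_open_nonempty _ ho ⟨τ, by
      have : (0:ℝ) < 1 / ((m : ℝ) + 1) := by positivity
      simp only [Set.mem_ofPred_eq, min_eq_left H, max_eq_right h0]
      linarith⟩
    exact ⟨q, hx⟩

lemma hit_ae (hW : IsBrownianMotion P W) (A : ℝ) :
    ∀ᵐ ω ∂P, {t : ℝ | 0 ≤ t ∧ A ≤ |W t ω|}.Nonempty := by
  have := hW.isProb
  have hlim : Filter.Tendsto (fun n : ℕ => gaussianReal 0 1 (Set.Icc (-(A / ((n:ℝ) + 1))) (A / ((n:ℝ) + 1))))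
      Filter.atTop (nhds 0) := by
    rcases lt_or_ge A 0 with hA | hA
    · have : ∀ n : ℕ, gaussianReal 0 1 (Set.Icc (-(A / ((n:ℝ) + 1))) (A / ((n:ℝ) + 1))) = 0 := by
        intro n
        have : A / ((n:ℝ) + 1) < 0 := div_neg_of_neg_of_pos hA (by positivity)
        rw [Set.Icc_eq_empty (by linarith)]; simp
      simp [this]
    have hInt : (⋂ n : ℕ, Set.Icc (-(A / ((n:ℝ) + 1))) (A / ((n:ℝ) + 1))) ⊆ {0} := by
      intro x hx
      simp only [Set.mem_iInter] at hx
      have : Filter.Tendsto (fun n : ℕ => A / ((n:ℝ) + 1)) Filter.atTop (nhds 0) := by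
        have := (tendsto_one_div_add_atTop_nhds_zero_nat (𝕜 := ℝ)).const_mul A
        simpa [div_eq_mul_inv] using this
      have := ge_of_tendsto' this fun n => abs_le.2 (hx n)
      simpa using this
    have hz : gaussianReal 0 1 (⋂ n : ℕ, Set.Icc (-(A / ((n:ℝ) + 1))) (A / ((n:ℝ) + 1))) = 0 := by
      have := nullSingletonClass_gaussianReal (μ := 0) (v := 1) one_ne_zero
      exact measure_mono_null hInt (measure_singleton 0)
    rw [← hz]
    refine tendsto_measure_iInter_atTop (fun n => measurableSet_Icc.nullMeasurableSet) ?_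
      ⟨0, measure_ne_top _ _⟩
    intro n m hnm
    have : A / ((m:ℝ) + 1) ≤ A / ((n:ℝ) + 1) := by gcongr
    exact Set.Icc_subset_Icc (by linarith) this
  rw [ae_iff]
  refine le_antisymm (ge_of_tendsto' hlim fun n => ?_) bot_le
  have hmap := hW.incr 0 (((n:ℝ) + 1) ^ 2) le_rfl (by positivity)
  have hg : gaussianReal 0 (Real.toNNReal (((n:ℝ) + 1) ^ 2 - 0))
      = (gaussianReal 0 1).map (fun x => ((n:ℝ) + 1) * x) := by
    rw [gaussianReal_map_const_mul]
    congr 1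
    · simp
    · ext; simp
      positivity
  simp only [hW.start, sub_zero] at hmap hg
  rw [hg] at hmap
  have hpre : (fun x : ℝ => ((n:ℝ) + 1) * x) ⁻¹' (Set.Icc (-A) A)
      = Set.Icc (-(A / ((n:ℝ) + 1))) (A / ((n:ℝ) + 1)) := by
    ext x
    have hn : (0:ℝ) < (n:ℝ) + 1 := by positivity
    simp only [Set.mem_preimage, Set.mem_Icc, ← neg_div, div_le_iff₀ hn, le_div_iff₀ hn,
      mul_comm x]
  rw [← hpre, ← Measure.map_apply (by fun_prop) measurableSet_Icc, ← hmap,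
    Measure.map_apply (hW.meas _) measurableSet_Icc]
  refine measure_mono fun ω hω => ?_
  simp only [Set.mem_ofPred_eq, Set.not_nonempty_iff_eq_empty] at hω
  have h1 : ¬ (A ≤ |W (((n:ℝ) + 1) ^ 2) ω|) := fun hcon => by
    have : (((n:ℝ) + 1) ^ 2) ∈ {t : ℝ | 0 ≤ t ∧ A ≤ |W t ω|} := ⟨by positivity, hcon⟩
    rw [hω] at this
    exact this
  exact abs_le.1 (not_le.1 h1).le

lemma union_bound (hW : IsBrownianMotion P W) {h A : ℝ} (hh : 0 < h) (hA : 0 ≤ A) {ι : Type*}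
    [Countable ι] (t : ι → ℝ) (ht : ∀ i, t i ∈ Set.Icc 0 h) :
    P (⋃ i, hitE W A (t i)) ≤ ENNReal.ofReal (2 * Real.exp (- A ^ 2 / (2 * h))) := by
  have hl : Filter.Tendsto (fun m : ℕ => ENNReal.ofReal
      (2 * Real.exp (-(A / h * (A - 1 / ((m:ℝ) + 1))) + h * (A / h) ^ 2 / 2))) Filter.atTop
      (nhds (ENNReal.ofReal (2 * Real.exp (- A ^ 2 / (2 * h))))) := by
    have h1 := tendsto_one_div_add_atTop_nhds_zero_nat (𝕜 := ℝ)
    have hc : Continuous fun x : ℝ => ENNReal.ofReal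
      (2 * Real.exp (-(A / h * (A - x)) + h * (A / h) ^ 2 / 2)) :=
      ENNReal.continuous_ofReal.comp (by fun_prop)
    have := (hc.tendsto 0).comp h1
    have e : - A ^ 2 / (2 * h) = -(A / h * (A - 0)) + h * (A / h) ^ 2 / 2 := by
      field_simp; ring
    rw [e]
    exact this
  refine ge_of_tendsto' hl fun m => ?_
  have hb := fun l => maximal_count hW hh.le (ι := ι × ℚ)
    (fun p => max 0 (min (p.2 : ℝ) (t p.1)))
    (fun p => ⟨le_max_left _ _, max_le hh.le ((min_le_right _ _).trans (ht p.1).2)⟩) l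
    (A / h * (A - 1 / ((m:ℝ) + 1)))
  have h1 := hb (A / h)
  have h2 := hb (-(A / h))
  rw [neg_sq] at h2
  rw [two_mul, ENNReal.ofReal_add (by positivity) (by positivity)]
  refine le_trans (measure_mono ?_) ((measure_union_le _ _).trans (add_le_add h1 h2))
  intro ω hω
  simp only [hitE, Set.mem_iUnion, Set.mem_iInter, Set.mem_ofPred_eq] at hω
  obtain ⟨i, hi⟩ := hω
  obtain ⟨q, hq⟩ := hi m
  have hAh : 0 ≤ A / h := by positivity
  simp only [Set.mem_union, Set.mem_iUnion, Set.mem_ofPred_eq]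
  rcases lt_abs.1 hq with hq | hq
  · exact Or.inl ⟨(i, q), mul_le_mul_of_nonneg_left hq.le hAh⟩
  · refine Or.inr ⟨(i, q), ?_⟩
    rw [neg_mul, ← mul_neg]
    exact mul_le_mul_of_nonneg_left hq.le hAh

lemma main_bound (hW : IsBrownianMotion P W) {h A : ℝ} (hh : 0 < h) (hA : 0 ≤ A) :
    ∫⁻ ω, ENNReal.ofReal ((W h ω - W (min h (sInf {t : ℝ | 0 ≤ t ∧ A ≤ |W t ω|})) ω) ^ 4) ∂P
      ≤ ENNReal.ofReal (3 * h ^ 2) * ENNReal.ofReal (2 * Real.exp (- A ^ 2 / (2 * h))) := by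
  set t : ℕ → ℕ → ℝ := fun n k => h * k / ((n:ℝ) + 1) with ht
  have ht0 : ∀ n k, 0 ≤ t n k := fun n k => by positivity
  have hth : ∀ n k, k ≤ n + 1 → t n k ≤ h := fun n k hk => by
    simp only [ht]
    rw [div_le_iff₀ (by positivity)]
    have : (k:ℝ) ≤ (n:ℝ) + 1 := by exact_mod_cast hk
    gcongr
  set D : ℕ → ℕ → Set Ω := fun n k => hitE W A (t n k) \ ⋃ j ∈ Finset.range k, hitE W A (t n j)
    with hD
  have hDm : ∀ n k, MeasurableSet[past W (t n k)] (D n k) := by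
    intro n k
    refine MeasurableSet.diff (hitE_meas A (ht0 n k)) ?_
    refine Finset.measurableSet_biUnion _ fun j hj => ?_
    have hle : past W (t n j) ≤ past W (t n k) := by
      refine iSup₂_le fun r hr => ?_
      refine (past_meas W hr.1 (hr.2.trans ?_)).comap_le
      have : (j:ℝ) ≤ k := by exact_mod_cast (Finset.mem_range.1 hj).le
      simp only [ht]; gcongr
    exact hle _ (hitE_meas A (ht0 n j))
  have hDm' : ∀ n k, MeasurableSet (D n k) := fun n k => past_le hW _ _ (hDm n k)
  set f : ℕ → Ω → ENNReal := fun n ω => ∑ k ∈ Finset.range (n + 2),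
    ENNReal.ofReal ((W h ω - W (t n k) ω) ^ 4) * (D n k).indicator (fun _ => 1) ω with hf
  have hterm_meas : ∀ n k, Measurable fun ω => ENNReal.ofReal ((W h ω - W (t n k) ω) ^ 4) *
      (D n k).indicator (fun _ => (1:ENNReal)) ω := fun n k =>
    (((hW.meas h).sub (hW.meas _)).pow_const 4).ennreal_ofReal.mul
      (measurable_const.indicator (hDm' n k))
  have hfm : ∀ n, Measurable (f n) := fun n =>
    Finset.measurable_fun_sum _ fun k _ => hterm_meas n k
  have hfb : ∀ n, ∫⁻ ω, f n ω ∂P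
      ≤ ENNReal.ofReal (3 * h ^ 2) * ENNReal.ofReal (2 * Real.exp (- A ^ 2 / (2 * h))) := by
    intro n
    rw [lintegral_finsetSum _ fun k _ => hterm_meas n k]
    have hdisj : ((Finset.range (n + 2) : Finset ℕ) : Set ℕ).PairwiseDisjoint (D n) := by
      have key : ∀ r s, r < s → Disjoint (D n r) (D n s) := by
        intro r s hrs
        rw [Set.disjoint_left]
        intro ω h1 h2
        refine h2.2 ?_
        simp only [Set.mem_iUnion, Finset.mem_range]
        exact ⟨r, hrs, h1.1⟩
      intro r _ s _ hne
      rcases lt_or_gt_of_ne hne with hlt | hlt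
      · exact key r s hlt
      · exact (key s r hlt).symm
    calc _ ≤ ∑ k ∈ Finset.range (n + 2), ENNReal.ofReal (3 * h ^ 2) * P (D n k) := by
          refine Finset.sum_le_sum fun k hk => ?_
          have hk' := hth n k (by have := Finset.mem_range.1 hk; omega)
          rw [factor hW (ht0 n k) hk' (fun x => ENNReal.ofReal (x ^ 4)) (by fun_prop) _
            (measurable_const.indicator (hDm n k)), gauss4,
            lintegral_indicator_const (hDm' n k), one_mul]
          refine mul_le_mul_left (ENNReal.ofReal_le_ofReal ?_) _
          rw [Real.coe_toNNReal _ (by linarith)]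
          have := ht0 n k
          have : (h - t n k) ^ 2 ≤ h ^ 2 := pow_le_pow_left₀ (by linarith) (by linarith) 2
          linarith
      _ = ENNReal.ofReal (3 * h ^ 2) * P (⋃ k ∈ Finset.range (n + 2), D n k) := by
          rw [← Finset.mul_sum, measure_biUnion_finset hdisj fun k _ => hDm' n k]
      _ ≤ _ := by
          gcongr
          refine le_trans (measure_mono ?_) (union_bound hW hh hA
            (fun k : Fin (n + 2) => t n k) fun k => ⟨ht0 _ _, hth _ _ (by omega)⟩)
          intro ω hω
          simp only [Set.mem_iUnion, Finset.mem_range] at hω ⊢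
          obtain ⟨k, hk, hω⟩ := hω
          exact ⟨⟨k, hk⟩, hω.1⟩
  have hlim : ∀ᵐ ω ∂P,
      ENNReal.ofReal ((W h ω - W (min h (sInf {t : ℝ | 0 ≤ t ∧ A ≤ |W t ω|})) ω) ^ 4)
        ≤ Filter.liminf (fun n => f n ω) Filter.atTop := by
    filter_upwards [hW.cont, hit_ae hW A] with ω hc hne
    have hiff := fun s hs => mem_hitE_iff (W := W) (A := A) (t := s) hs hc hne
    have hτ0 : 0 ≤ sInf {t : ℝ | 0 ≤ t ∧ A ≤ |W t ω|} := Real.sInf_nonneg fun x hx => hx.1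
    set τ := sInf {t : ℝ | 0 ≤ t ∧ A ≤ |W t ω|}
    rcases lt_or_ge h τ with hτ | hτ
    · simp [min_eq_left hτ.le]
    rw [min_eq_right hτ]
    set κ : ℕ → ℕ := fun n => ⌈τ * ((n:ℝ) + 1) / h⌉₊ with hκ
    have hκ1 : ∀ n, τ ≤ t n (κ n) := by
      intro n
      have := Nat.le_ceil (τ * ((n:ℝ) + 1) / h)
      rw [div_le_iff₀ hh] at this
      simp only [ht]
      rw [le_div_iff₀ (by positivity), mul_comm h]
      exact this
    have hκ2 : ∀ n, t n (κ n) ≤ τ + h * (1 / ((n:ℝ) + 1)) := by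
      intro n
      have hn : (0:ℝ) < (n:ℝ) + 1 := by positivity
      have := (Nat.ceil_lt_add_one (a := τ * ((n:ℝ) + 1) / h) (by positivity)).le
      calc t n (κ n) ≤ h * (τ * ((n:ℝ) + 1) / h + 1) / ((n:ℝ) + 1) := by
            simp only [ht]; gcongr
        _ = _ := by field_simp
    have hκ3 : ∀ n, κ n < n + 2 := by
      intro n
      have : κ n ≤ n + 1 := by
        refine Nat.ceil_le.2 ?_
        push_cast
        rw [div_le_iff₀ hh, mul_comm]
        gcongr
      omega
    have htend : Filter.Tendsto (fun n => t n (κ n)) Filter.atTop (nhds τ) := by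
      have h1 : Filter.Tendsto (fun n : ℕ => τ + h * (1 / ((n:ℝ) + 1))) Filter.atTop (nhds τ) := by
        simpa using ((tendsto_one_div_add_atTop_nhds_zero_nat (𝕜 := ℝ)).const_mul h).const_add τ
      exact tendsto_of_tendsto_of_tendsto_of_le_of_le tendsto_const_nhds h1 hκ1 hκ2
    have hmem : ∀ n, ω ∈ D n (κ n) := by
      intro n
      refine ⟨(hiff _ (ht0 _ _)).2 (hκ1 n), ?_⟩
      simp only [Set.mem_iUnion, Finset.mem_range]
      rintro ⟨j, hj, hjω⟩
      have h1 := (hiff _ (ht0 _ _)).1 hjω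
      have h2 : (j:ℝ) < τ * ((n:ℝ) + 1) / h := Nat.lt_ceil.1 hj
      rw [lt_div_iff₀ hh] at h2
      have h3 : τ ≤ h * j / ((n:ℝ) + 1) := h1
      rw [le_div_iff₀ (by positivity)] at h3
      linarith
    have hlow : ∀ n, ENNReal.ofReal ((W h ω - W (t n (κ n)) ω) ^ 4) ≤ f n ω := by
      intro n
      have := Finset.single_le_sum (f := fun k => ENNReal.ofReal ((W h ω - W (t n k) ω) ^ 4) *
        (D n k).indicator (fun _ => (1:ENNReal)) ω) (fun _ _ => zero_le)
        (Finset.mem_range.2 (hκ3 n))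
      simpa [hmem n] using this
    have hg : Continuous fun s => ENNReal.ofReal ((W h ω - W s ω) ^ 4) :=
      ENNReal.continuous_ofReal.comp ((continuous_const.sub hc).pow 4)
    have := ((hg.tendsto τ).comp htend).liminf_eq
    rw [← this]
    exact Filter.liminf_le_liminf (Filter.Eventually.of_forall hlow)
  refine (lintegral_mono_ae hlim).trans ((lintegral_liminf_le hfm).trans ?_)
  refine (Filter.liminf_le_liminf (Filter.Eventually.of_forall hfb)).trans ?_
  simp

end

/-- **Fourth-moment bound for the truncated Brownian increment with general truncation
level.** For `h ∈ (0,1]`, `K > 0`, `A := K√(h log(1/h))`, and `τ` the first exit time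
of `W` from `(−A, A)`, one has `E[(W_h − W_{h∧τ})⁴] ≤ 6 h^{2 + K²/2}`. -/
theorem truncated_brownian_increment_fourth_moment_general
    {Ω : Type*} [MeasurableSpace Ω] (P : Measure Ω) (W : ℝ → Ω → ℝ)
    (hW : IsBrownianMotion P W) (h : ℝ) (hh0 : 0 < h) (hh1 : h ≤ 1)
    (K : ℝ) (hK : 0 < K)
    (A : ℝ) (hA : A = K * Real.sqrt (h * Real.log (1 / h)))
    (τ : Ω → ℝ) (hτ : τ = fun ω => sInf {t : ℝ | 0 ≤ t ∧ A ≤ |W t ω|}) :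
    ∫⁻ ω, ENNReal.ofReal ((W h ω - W (min h (τ ω)) ω) ^ 4) ∂P
      ≤ ENNReal.ofReal (6 * h ^ ((2 : ℝ) + K ^ 2 / 2)) := by
  subst hτ
  have hA0 : 0 ≤ A := by rw [hA]; positivity
  refine (main_bound hW hh0 hA0).trans_eq ?_
  rw [← ENNReal.ofReal_mul (by positivity)]
  congr 1
  have hlog : 0 ≤ Real.log (1 / h) := Real.log_nonneg (by rw [le_div_iff₀ hh0]; linarith)
  have hA2 : A ^ 2 = K ^ 2 * (h * Real.log (1 / h)) := by
    rw [hA, mul_pow, Real.sq_sqrt (by positivity)]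
  have he : Real.exp (- A ^ 2 / (2 * h)) = h ^ (K ^ 2 / 2) := by
    rw [hA2, Real.rpow_def_of_pos hh0, one_div, Real.log_inv]
    congr 1
    field_simp
  rw [he, Real.rpow_add hh0, Real.rpow_two]
  ring
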